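/- arXiv:2309.12911 — 2 statements merged into one kernel-verified Lean document; each statement's English description precedes it below -/
import Mathlib

section
/- (Algebraic core of Lemma 3.1 (i).) Let ν ∈ ℝ³ be a unit vector, let η, τ ∈ ℝ with d = η² − τ² ≠ −4, let M = (i/2)(α·ν)(η I₄ + τ β), and let R_{η,τ} = (I₄ − M)⁻¹(I₄ + M). Then for all vectors u₊, u₋ ∈ ℂ⁴, the transmission condition i(α·ν)(u₊ − u₋) + (1/2)(η I₄ + τ β)(u₊ + u₋) = 0 holds if and only if u₊ = R_{η,τ} u₋. -/
open Matrix

/-- The Pauli matrices σ₁, σ₂, σ₃. -/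
noncomputable def pauli : Fin 3 → Matrix (Fin 2) (Fin 2) ℂ :=
  ![!![0, 1; 1, 0], !![0, -Complex.I; Complex.I, 0], !![1, 0; 0, -1]]

/-- The Dirac matrices α₁, α₂, α₃, in 2×2 block form αₖ = [[0, σₖ], [σₖ, 0]]. -/
noncomputable def diracAlpha (k : Fin 3) : Matrix (Fin 4) (Fin 4) ℂ :=
  Matrix.reindex finSumFinEquiv finSumFinEquiv
    (Matrix.fromBlocks 0 (pauli k) (pauli k) 0)

/-- The Dirac matrix β = [[I₂, 0], [0, -I₂]]. -/
noncomputable def diracBeta : Matrix (Fin 4) (Fin 4) ℂ :=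
  Matrix.reindex finSumFinEquiv finSumFinEquiv
    (Matrix.fromBlocks (1 : Matrix (Fin 2) (Fin 2) ℂ) (0 : Matrix (Fin 2) (Fin 2) ℂ) (0 : Matrix (Fin 2) (Fin 2) ℂ) (-1 : Matrix (Fin 2) (Fin 2) ℂ))

/-- For ν ∈ ℝ³, the matrix α·ν = ν₁α₁ + ν₂α₂ + ν₃α₃. -/
noncomputable def alphaDot (ν : Fin 3 → ℝ) : Matrix (Fin 4) (Fin 4) ℂ :=
  (ν 0 : ℂ) • diracAlpha 0 + (ν 1 : ℂ) • diracAlpha 1 + (ν 2 : ℂ) • diracAlpha 2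

/-- The matrix σ·ν = ν₁σ₁ + ν₂σ₂ + ν₃σ₃. -/
noncomputable def pauliDot (ν : Fin 3 → ℝ) : Matrix (Fin 2) (Fin 2) ℂ :=
  (ν 0 : ℂ) • pauli 0 + (ν 1 : ℂ) • pauli 1 + (ν 2 : ℂ) • pauli 2

theorem pauliDot_mul_self (ν : Fin 3 → ℝ) :
    pauliDot ν * pauliDot ν = ((ν 0 ^ 2 + ν 1 ^ 2 + ν 2 ^ 2 : ℝ) : ℂ) • 1 := by
  ext i j
  fin_cases i <;> fin_cases j <;> simp [pauliDot, pauli, Matrix.mul_apply, Fin.sum_univ_two] <;>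
    ring_nf <;> simp

theorem alphaDot_eq_reindex (ν : Fin 3 → ℝ) :
    alphaDot ν = Matrix.reindexAlgEquiv ℂ ℂ finSumFinEquiv
      (Matrix.fromBlocks 0 (pauliDot ν) (pauliDot ν) 0) := by
  have h : Matrix.fromBlocks 0 (pauliDot ν) (pauliDot ν) 0 =
      (ν 0 : ℂ) • Matrix.fromBlocks 0 (pauli 0) (pauli 0) 0 +
      (ν 1 : ℂ) • Matrix.fromBlocks 0 (pauli 1) (pauli 1) 0 +
      (ν 2 : ℂ) • Matrix.fromBlocks 0 (pauli 2) (pauli 2) 0 := by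
    simp [Matrix.fromBlocks_smul, Matrix.fromBlocks_add, pauliDot]
  rw [h, map_add, map_add, map_smul, map_smul, map_smul]
  rfl

theorem diracBeta_eq_reindex :
    diracBeta = Matrix.reindexAlgEquiv ℂ ℂ (finSumFinEquiv (m := 2) (n := 2))
      (Matrix.fromBlocks 1 0 0 (-1)) :=
  rfl

theorem alphaDot_mul_self {ν : Fin 3 → ℝ} (hν : ν 0 ^ 2 + ν 1 ^ 2 + ν 2 ^ 2 = 1) :
    alphaDot ν * alphaDot ν = 1 := by
  rw [alphaDot_eq_reindex, ← map_mul, Matrix.fromBlocks_multiply]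
  simp [pauliDot_mul_self, hν, Matrix.fromBlocks_one]

theorem diracBeta_mul_self : diracBeta * diracBeta = 1 := by
  rw [diracBeta_eq_reindex, ← map_mul, Matrix.fromBlocks_multiply]
  simp [Matrix.fromBlocks_one]

theorem diracBeta_mul_alphaDot (ν : Fin 3 → ℝ) :
    diracBeta * alphaDot ν = -(alphaDot ν * diracBeta) := by
  rw [alphaDot_eq_reindex, diracBeta_eq_reindex, ← map_mul, ← map_mul, ← map_neg,
    Matrix.fromBlocks_multiply, Matrix.fromBlocks_multiply, Matrix.fromBlocks_neg]
  simp

/-- The matrix M = (i/2)(α·ν)(η I₄ + τβ) satisfies M² = -(η² - τ²)/4. -/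
theorem transmissionMatrix_mul_self {ν : Fin 3 → ℝ} (hν : ν 0 ^ 2 + ν 1 ^ 2 + ν 2 ^ 2 = 1)
    (η τ : ℂ) :
    ((Complex.I / 2) • (alphaDot ν * (η • 1 + τ • diracBeta))) *
      ((Complex.I / 2) • (alphaDot ν * (η • 1 + τ • diracBeta))) =
      (-(η ^ 2 - τ ^ 2) / 4) • 1 := by
  have hcomm : (η • 1 + τ • diracBeta) * alphaDot ν =
      alphaDot ν * (η • 1 - τ • diracBeta) := by
    simp [add_mul, mul_add, diracBeta_mul_alphaDot, sub_eq_add_neg]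
  have hprod : (η • 1 - τ • diracBeta) * (η • 1 + τ • diracBeta) = (η ^ 2 - τ ^ 2) • 1 := by
    simp only [sub_mul, mul_add, smul_mul_smul_comm, one_mul, mul_one, diracBeta_mul_self]
    module
  have hI : Complex.I / 2 * (Complex.I / 2) = -1 / 4 := by
    linear_combination Complex.I_mul_I / 4
  rw [smul_mul_smul_comm, mul_assoc, ← mul_assoc _ (alphaDot ν), hcomm, mul_assoc, hprod,
    ← mul_assoc, alphaDot_mul_self hν, one_mul, smul_smul, hI]
  congr 1
  ring

/-- Algebraic core of Lemma 3.1 (i): for d = η² − τ² ≠ −4, the transmission condition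
i(α·ν)(uPlus − uMinus) + (1/2)(η I₄ + τβ)(uPlus + uMinus) = 0 holds iff uPlus = R_{η,τ} uMinus,
with R_{η,τ} = (I₄ − M)⁻¹(I₄ + M). -/
theorem transmission_condition_iff (ν : Fin 3 → ℝ) (hν : ν 0 ^ 2 + ν 1 ^ 2 + ν 2 ^ 2 = 1)
    (η τ d : ℝ) (hd : d = η ^ 2 - τ ^ 2) (hd4 : d ≠ -4)
    (M : Matrix (Fin 4) (Fin 4) ℂ)
    (hM : M = (Complex.I / 2) • (alphaDot ν * ((η : ℂ) • 1 + (τ : ℂ) • diracBeta)))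
    (R : Matrix (Fin 4) (Fin 4) ℂ) (hR : R = (1 - M)⁻¹ * (1 + M)) :
    ∀ uPlus uMinus : Fin 4 → ℂ,
      (Complex.I • alphaDot ν).mulVec (uPlus - uMinus)
          + (((1 : ℂ) / 2) • ((η : ℂ) • 1 + (τ : ℂ) • diracBeta)).mulVec (uPlus + uMinus) = 0
        ↔ uPlus = R.mulVec uMinus := by
  intro uPlus uMinus
  set A := alphaDot ν
  set N : Matrix (Fin 4) (Fin 4) ℂ := (η : ℂ) • 1 + (τ : ℂ) • diracBeta
  have hA : A * A = 1 := alphaDot_mul_self hν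
  have hM2 : M * M = (-((η : ℂ) ^ 2 - (τ : ℂ) ^ 2) / 4) • 1 := by
    rw [hM]
    exact transmissionMatrix_mul_self hν η τ
  have hne : (1 + (d : ℂ) / 4) ≠ 0 := by
    intro h
    apply hd4
    have : (d : ℂ) = ((-4 : ℝ) : ℂ) := by
      push_cast
      linear_combination 4 * h
    exact_mod_cast this
  have hfactor : (1 - M) * (1 + M) = (1 + (d : ℂ) / 4) • 1 := by
    have : (1 - M) * (1 + M) = 1 - M * M := by noncomm_ring
    rw [this, hM2, hd]
    push_cast
    module
  have hunit : IsUnit (1 - M).det := by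
    apply Matrix.isUnit_det_of_right_inverse (B := (1 + (d : ℂ) / 4)⁻¹ • (1 + M))
    rw [mul_smul_comm, hfactor, smul_smul, inv_mul_cancel₀ hne, one_smul]
  have hcondition : (Complex.I • A) *ᵥ (uPlus - uMinus) + (((1 : ℂ) / 2) • N) *ᵥ (uPlus + uMinus) =
      (Complex.I • A) *ᵥ ((1 - M) *ᵥ uPlus - (1 + M) *ᵥ uMinus) := by
    have hAM : (Complex.I • A) * M = -(((1 : ℂ) / 2) • N) := by
      rw [hM, smul_mul_smul_comm, ← mul_assoc, hA, one_mul, ← neg_smul]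
      congr 1
      linear_combination Complex.I_mul_I / 2
    have : (1 - M) *ᵥ uPlus - (1 + M) *ᵥ uMinus = (uPlus - uMinus) - M *ᵥ (uPlus + uMinus) := by
      rw [sub_mulVec, add_mulVec, mulVec_add, one_mulVec, one_mulVec]
      abel
    rw [this, mulVec_sub _ (uPlus - uMinus), mulVec_mulVec, hAM, neg_mulVec, sub_neg_eq_add]
  have hcancel : (-Complex.I • A) * (Complex.I • A) = 1 := by
    rw [smul_mul_smul_comm, hA, neg_mul, Complex.I_mul_I, neg_neg, one_smul]
  rw [hcondition, hR, ← mulVec_mulVec]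
  constructor
  · intro h
    have h' := congrArg ((-Complex.I • A) *ᵥ ·) h
    simp only [mulVec_mulVec, hcancel, one_mulVec, mulVec_zero] at h'
    rw [← sub_eq_zero.mp h', mulVec_mulVec, nonsing_inv_mul _ hunit, one_mulVec]
  · intro h
    rw [h, mulVec_mulVec, mul_nonsing_inv _ hunit, one_mulVec, sub_self, mulVec_zero]
end

section
/- Let η, τ ∈ ℝ and d = η² − τ², and define the renormalized couplings (η̂, τ̂) by: (η̂, τ̂) = (tanh(√(−d)/2)/(√(−d)/2))·(η, τ) if d < 0; (η̂, τ̂) = (η, τ) if d = 0; and (η̂, τ̂) = (tan(√d/2)/(√d/2))·(η, τ) if d > 0 with d ≠ (2k+1)²π² for every integer k ≥ 0. Set d̂ = η̂² − τ̂². Then d̂ = −4 tanh²(√(−d)/2) if d < 0, d̂ = 0 if d = 0, and d̂ = 4 tan²(√d/2) if d > 0; in particular, in all cases d̂ > −4 (so d̂ ≠ −4). -/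
/-- The renormalized couplings (η̂, τ̂), defined from (η, τ) with d = η² − τ² by
(η̂, τ̂) = (tanh(√(−d)/2)/(√(−d)/2))·(η, τ) if d < 0, (η̂, τ̂) = (η, τ) if d = 0, and
(η̂, τ̂) = (tan(√d/2)/(√d/2))·(η, τ) if d > 0 with d ≠ (2k+1)²π² for all k ≥ 0,
satisfy d̂ = η̂² − τ̂² = −4 tanh²(√(−d)/2), 0, and 4 tan²(√d/2) respectively; in
particular in all cases d̂ > −4. -/
theorem renormalized_coupling_constant (η τ d : ℝ) (hd : d = η ^ 2 - τ ^ 2)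
    (hk : 0 < d → ∀ k : ℕ, d ≠ (2 * (k : ℝ) + 1) ^ 2 * Real.pi ^ 2)
    (ηr τr : ℝ)
    (hneg : d < 0 →
      ηr = Real.tanh (Real.sqrt (-d) / 2) / (Real.sqrt (-d) / 2) * η ∧
      τr = Real.tanh (Real.sqrt (-d) / 2) / (Real.sqrt (-d) / 2) * τ)
    (hzero : d = 0 → ηr = η ∧ τr = τ)
    (hpos : 0 < d →
      ηr = Real.tan (Real.sqrt d / 2) / (Real.sqrt d / 2) * η ∧
      τr = Real.tan (Real.sqrt d / 2) / (Real.sqrt d / 2) * τ)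
    (dr : ℝ) (hdr : dr = ηr ^ 2 - τr ^ 2) :
    (d < 0 → dr = -4 * Real.tanh (Real.sqrt (-d) / 2) ^ 2) ∧
    (d = 0 → dr = 0) ∧
    (0 < d → dr = 4 * Real.tan (Real.sqrt d / 2) ^ 2) ∧
    dr > -4 := by
  have hneg' : d < 0 → dr = -4 * Real.tanh (Real.sqrt (-d) / 2) ^ 2 := by
    intro h
    obtain ⟨h₁, h₂⟩ := hneg h
    have hs : Real.sqrt (-d) ≠ 0 := (Real.sqrt_pos.2 (by linarith)).ne'
    have hsq : Real.sqrt (-d) ^ 2 = -d := Real.sq_sqrt (by linarith)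
    calc dr = (Real.tanh (Real.sqrt (-d) / 2) / (Real.sqrt (-d) / 2)) ^ 2 * -(-d) := by
          rw [hdr, h₁, h₂, neg_neg, hd]; ring
      _ = (Real.tanh (Real.sqrt (-d) / 2) / (Real.sqrt (-d) / 2)) ^ 2 * -Real.sqrt (-d) ^ 2 := by
          rw [hsq]
      _ = -4 * Real.tanh (Real.sqrt (-d) / 2) ^ 2 := by field_simp; ring
  have hzero' : d = 0 → dr = 0 := by
    intro h
    obtain ⟨rfl, rfl⟩ := hzero h
    rw [hdr, ← hd, h]
  have hpos' : 0 < d → dr = 4 * Real.tan (Real.sqrt d / 2) ^ 2 := by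
    intro h
    obtain ⟨h₁, h₂⟩ := hpos h
    have hs : Real.sqrt d ≠ 0 := (Real.sqrt_pos.2 h).ne'
    have hsq : Real.sqrt d ^ 2 = d := Real.sq_sqrt h.le
    calc dr = (Real.tan (Real.sqrt d / 2) / (Real.sqrt d / 2)) ^ 2 * d := by
          rw [hdr, h₁, h₂, hd]; ring
      _ = (Real.tan (Real.sqrt d / 2) / (Real.sqrt d / 2)) ^ 2 * Real.sqrt d ^ 2 := by rw [hsq]
      _ = 4 * Real.tan (Real.sqrt d / 2) ^ 2 := by field_simp; ring
  refine ⟨hneg', hzero', hpos', ?_⟩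
  rcases lt_trichotomy d 0 with h | h | h
  · rw [hneg' h]
    have : Real.tanh (Real.sqrt (-d) / 2) ^ 2 < 1 := Real.tanh_sq_lt_one _
    linarith
  · rw [hzero' h]
    norm_num
  · rw [hpos' h]
    have := sq_nonneg (Real.tan (Real.sqrt d / 2))
    linarith
end
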